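/- arXiv:2404.02574 — 2 statements merged into one kernel-verified Lean document; each statement's English description precedes it below -/
import Mathlib

section
/- (Theorem 1, case ν = 0.) Suppose J ≢ 0 (mod q) and let J^{−1} ∈ Z_q be its multiplicative inverse. Let x_0 ∈ Z_q^n and y: Z_{≥0} → Z_q be a message initial state and input sequence, and let B_x ∈ Z_q^n and B_y: Z_{≥0} → Z_q be arbitrary masking values. Then there exists a unique sequence y': Z_{≥0} → Z_q such that S(x_0 + B_x, {y(τ) + (B_y(τ) − y'(τ))}_{τ=0}^{t}) = S(x_0, {y(τ)}_{τ=0}^{t}) for all t ≥ 0; moreover it is given by y'(t) = B_y(t) + J^{−1}·H·(F − G·J^{−1}·H)^t·B_x mod q for all t ≥ 0. -/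
open Matrix

/-- State trajectory of the linear system `x(t+1) = F x(t) + G y(t)` over `ZMod q`. -/
def traj (q n : ℕ) (F : Matrix (Fin n) (Fin n) (ZMod q)) (G : Fin n → ZMod q)
    (x0 : Fin n → ZMod q) (y : ℕ → ZMod q) : ℕ → Fin n → ZMod q
  | 0 => x0
  | t + 1 => F *ᵥ traj q n F G x0 y t + y t • G

/-- Output `r(t) = H x(t) + J y(t)` of the linear system over `ZMod q`. -/
def out (q n : ℕ) (F : Matrix (Fin n) (Fin n) (ZMod q)) (G H : Fin n → ZMod q)
    (J : ZMod q) (x0 : Fin n → ZMod q) (y : ℕ → ZMod q) (t : ℕ) : ZMod q :=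
  H ⬝ᵥ traj q n F G x0 y t + J * y t

theorem traj_add (q n : ℕ) (F : Matrix (Fin n) (Fin n) (ZMod q)) (G x0 x1 : Fin n → ZMod q)
    (y d : ℕ → ZMod q) (t : ℕ) :
    traj q n F G (x0 + x1) (fun τ => y τ + d τ) t = traj q n F G x0 y t + traj q n F G x1 d t := by
  induction t with
  | zero => rfl
  | succ t ih =>
    simp only [traj, ih, mulVec_add, add_smul]
    abel

/-- Superposition: the output is additive in the initial state and the input jointly. -/
theorem out_add (q n : ℕ) (F : Matrix (Fin n) (Fin n) (ZMod q)) (G H : Fin n → ZMod q)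
    (J : ZMod q) (x0 x1 : Fin n → ZMod q) (y d : ℕ → ZMod q) (t : ℕ) :
    out q n F G H J (x0 + x1) (fun τ => y τ + d τ) t =
      out q n F G H J x0 y t + out q n F G H J x1 d t := by
  simp only [out, traj_add, dotProduct_add]
  ring

theorem closedLoop_pow_succ_mulVec {R m : Type*} [CommRing R] [Fintype m] [DecidableEq m]
    (F : Matrix m m R) (G H x : m → R) (k : R) (t : ℕ) :
    (F - k • vecMulVec G H) ^ (t + 1) *ᵥ x =
      F *ᵥ ((F - k • vecMulVec G H) ^ t *ᵥ x) +
        (-(k * (H ⬝ᵥ ((F - k • vecMulVec G H) ^ t *ᵥ x)))) • G := by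
  rw [pow_succ', ← mulVec_mulVec, sub_mulVec, smul_mulVec, vecMulVec_mulVec]
  ext i
  simp only [Pi.sub_apply, Pi.add_apply, Pi.smul_apply, smul_eq_mul,
    MulOpposite.smul_eq_mul_unop, MulOpposite.unop_op]
  ring

/-- The inputs that keep the output at zero are exactly those given by the output-zeroing state
feedback. -/
theorem out_eq_zero_iff (q n : ℕ) [Fact q.Prime] (F : Matrix (Fin n) (Fin n) (ZMod q))
    (G H : Fin n → ZMod q) (J : ZMod q) (hJ : J ≠ 0) (x : Fin n → ZMod q) (d : ℕ → ZMod q) :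
    (∀ t, out q n F G H J x d t = 0) ↔
      ∀ t, d t = -(J⁻¹ * (H ⬝ᵥ ((F - J⁻¹ • vecMulVec G H) ^ t *ᵥ x))) := by
  have input_iff (v : Fin n → ZMod q) (a : ZMod q) :
      H ⬝ᵥ v + J * a = 0 ↔ a = -(J⁻¹ * (H ⬝ᵥ v)) := by
    constructor
    · intro h
      rw [eq_neg_of_add_eq_zero_left h, mul_neg, inv_mul_cancel_left₀ hJ, neg_neg]
    · rintro rfl
      rw [mul_neg, mul_inv_cancel_left₀ hJ, add_neg_cancel]
  simp only [out, input_iff]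
  constructor <;>
  · intro h
    have traj_eq (t : ℕ) :
        traj q n F G x d t = (F - J⁻¹ • vecMulVec G H) ^ t *ᵥ x := by
      induction t with
      | zero => simp [traj]
      | succ t ih => rw [closedLoop_pow_succ_mulVec, traj, h t, ih]
    intro t
    rw [h t, traj_eq t]

/-- Theorem 1, case ν = 0: if `J ≠ 0`, there exists a unique sequence
`y'` such that `S(x₀ + Bₓ, y + (B_y − y')) = S(x₀, y)` for all `t`; it is given by
`y'(t) = B_y(t) + J⁻¹ H (F − G J⁻¹ H)ᵗ Bₓ`. -/
theorem modified_encryption_discloses_residue_nu_zero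
    (q n : ℕ) (hq : Nat.Prime q)
    (F : Matrix (Fin n) (Fin n) (ZMod q)) (G H : Fin n → ZMod q) (J : ZMod q)
    (hJ : J ≠ 0)
    (x0 Bx : Fin n → ZMod q) (y By : ℕ → ZMod q) :
    let Fcl : Matrix (Fin n) (Fin n) (ZMod q) := F - J⁻¹ • vecMulVec G H
    let By' : ℕ → ZMod q := fun t => By t + J⁻¹ * (H ⬝ᵥ ((Fcl ^ t) *ᵥ Bx))
    (∀ t, out q n F G H J (x0 + Bx)
        (fun τ => y τ + (By τ - By' τ)) t = out q n F G H J x0 y t) ∧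
    (∀ y' : ℕ → ZMod q,
      (∀ t, out q n F G H J (x0 + Bx)
        (fun τ => y τ + (By τ - y' τ)) t = out q n F G H J x0 y t) →
      ∀ t, y' t = By' t) := by
  intro Fcl By'
  have : Fact q.Prime := ⟨hq⟩
  simp only [out_add, add_eq_left, out_eq_zero_iff q n F G H J hJ]
  refine ⟨fun t => ?_, fun y' h t => ?_⟩
  · simp only [By', Fcl]
    ring
  · simp only [By', Fcl]
    linear_combination -h t
end

section
/- (Remark 1: recovery of the equivalent input from the output sequence.) Let the system over Z_q have relative degree ν ≥ 1 and adopt the coordinate-change data T_1, T_2, V_1, V_2, with F_1 = T_1·F·V_1 mod q, F_2 = T_1·F·V_2 mod q, ψ = H·F^ν·V_1 mod q, φ = H·F^ν·V_2 mod q, and g = H·F^{ν−1}·G mod q. Along any trajectory with initial state x_0 and input y, define v(t) = [r(t), r(t+1), …, r(t+ν−1)]^T ∈ Z_q^ν from the output sequence, and define the equivalent input y'(t) = y(t) + g^{−1}·ψ·F_1^t·T_1·x_0 mod q. Then for all t ≥ 0, y'(t) = g^{−1}·( r(t+ν) − φ·v(t) − ψ·Σ_{τ=0}^{t−1} F_1^{t−1−τ}·F_2·v(τ)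 ) mod q; in particular, y'(t) is determined by the output sequence {r(τ)}_{τ=0}^{t+ν} alone. -/
open Matrix

/-- Variation of constants for an affine recursion `z (t + 1) = A z(t) + w(t)`. -/
theorem affine_recursion_solution {m : Type*} [Fintype m] [DecidableEq m] {R : Type*} [CommRing R]
    (A : Matrix m m R) (z w : ℕ → m → R) (h : ∀ t, z (t + 1) = A *ᵥ z t + w t) (t : ℕ) :
    z t = (A ^ t) *ᵥ z 0 + ∑ τ ∈ Finset.range t, (A ^ (t - 1 - τ)) *ᵥ w τ := by
  induction t with
  | zero => simp
  | succ t ih =>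
    have hsum : A *ᵥ (∑ τ ∈ Finset.range t, (A ^ (t - 1 - τ)) *ᵥ w τ) =
        ∑ τ ∈ Finset.range t, (A ^ (t + 1 - 1 - τ)) *ᵥ w τ := by
      rw [Matrix.mulVec_sum]
      refine Finset.sum_congr rfl fun τ hτ => ?_
      have hlt := Finset.mem_range.mp hτ
      rw [Matrix.mulVec_mulVec, ← pow_succ', show t - 1 - τ + 1 = t + 1 - 1 - τ by omega]
    rw [h, ih, Matrix.mulVec_add, hsum, Finset.sum_range_succ, Matrix.mulVec_mulVec, ← pow_succ']
    simp [add_assoc]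

/-- One step of the trajectory, observed through `u F ^ k`. -/
theorem vecMul_pow_dotProduct_traj_succ (q n : ℕ) (F : Matrix (Fin n) (Fin n) (ZMod q))
    (G x0 u : Fin n → ZMod q) (y : ℕ → ZMod q) (k t : ℕ) :
    (u ᵥ* F ^ k) ⬝ᵥ traj q n F G x0 y (t + 1) =
      (u ᵥ* F ^ (k + 1)) ⬝ᵥ traj q n F G x0 y t + y t * (u ⬝ᵥ ((F ^ k) *ᵥ G)) := by
  rw [traj, dotProduct_add, dotProduct_smul, dotProduct_mulVec, vecMul_vecMul, ← pow_succ,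
    smul_eq_mul, ← dotProduct_mulVec u (F ^ k) G]

/-- While the Markov parameters vanish, the observed state does not depend on the input. -/
theorem dotProduct_traj_add (q n : ℕ) (F : Matrix (Fin n) (Fin n) (ZMod q))
    (G x0 u : Fin n → ZMod q) (y : ℕ → ZMod q) (k : ℕ)
    (h : ∀ i < k, u ⬝ᵥ ((F ^ i) *ᵥ G) = 0) (t : ℕ) :
    u ⬝ᵥ traj q n F G x0 y (t + k) = (u ᵥ* F ^ k) ⬝ᵥ traj q n F G x0 y t := by
  induction k generalizing t with
  | zero => simp
  | succ k ih =>
    rw [show t + (k + 1) = t + 1 + k by omega, ih (fun i hi => h i (by omega)),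
      vecMul_pow_dotProduct_traj_succ, h k (by omega), mul_zero, add_zero]

/-- Remark 1: the equivalent input
`y'(t) = y(t) + g⁻¹ ψ F₁ᵗ T₁ x₀` can be recovered from the output sequence alone:
`y'(t) = g⁻¹ ( r(t+ν) − φ v(t) − ψ Σ_{τ=0}^{t-1} F₁^{t-1-τ} F₂ v(τ) )`, where
`v(t) = [r(t), …, r(t+ν-1)]ᵀ`. -/
theorem equivalent_input_from_output_sequence
    (q n ν : ℕ) (hq : Nat.Prime q) (hν : 1 ≤ ν) (hνn : ν ≤ n)
    (F : Matrix (Fin n) (Fin n) (ZMod q)) (G H : Fin n → ZMod q) (J : ZMod q)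
    (hJ : J = 0)
    (hlast : H ⬝ᵥ ((F ^ (ν - 1)) *ᵥ G) ≠ 0)
    (hzero : ∀ i : ℕ, i + 2 ≤ ν → H ⬝ᵥ ((F ^ i) *ᵥ G) = 0)
    (T1 : Matrix (Fin (n - ν)) (Fin n) (ZMod q))
    (T2 : Matrix (Fin ν) (Fin n) (ZMod q))
    (V1 : Matrix (Fin n) (Fin (n - ν)) (ZMod q))
    (V2 : Matrix (Fin n) (Fin ν) (ZMod q))
    (hT2 : ∀ (i : Fin ν) (j : Fin n), T2 i j = (H ᵥ* F ^ (i : ℕ)) j)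
    (hT1G : T1 *ᵥ G = 0)
    (hT1V1 : T1 * V1 = 1) (hT1V2 : T1 * V2 = 0)
    (hT2V1 : T2 * V1 = 0) (hT2V2 : T2 * V2 = 1)
    (hVT : V1 * T1 + V2 * T2 = 1)
    (x0 : Fin n → ZMod q) (y : ℕ → ZMod q) :
    let F1 := T1 * F * V1
    let F2 := T1 * F * V2
    let ψ : Fin (n - ν) → ZMod q := (H ᵥ* F ^ ν) ᵥ* V1
    let φ : Fin ν → ZMod q := (H ᵥ* F ^ ν) ᵥ* V2
    let g : ZMod q := H ⬝ᵥ ((F ^ (ν - 1)) *ᵥ G)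
    let r : ℕ → ZMod q := out q n F G H J x0 y
    let v : ℕ → Fin ν → ZMod q := fun t i => r (t + (i : ℕ))
    let y' : ℕ → ZMod q := fun t => y t + g⁻¹ * (ψ ⬝ᵥ ((F1 ^ t) *ᵥ (T1 *ᵥ x0)))
    ∀ t : ℕ, y' t = g⁻¹ *
      (r (t + ν) - φ ⬝ᵥ v t -
        ψ ⬝ᵥ (∑ τ ∈ Finset.range t, (F1 ^ (t - 1 - τ)) *ᵥ (F2 *ᵥ v τ))) := by
  intro F1 F2 ψ φ g r v y' t
  have : Fact q.Prime := ⟨hq⟩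
  have hr : ∀ s, r s = H ⬝ᵥ traj q n F G x0 y s := fun s => by
    simp [r, out, hJ]
  have hv : ∀ s, v s = T2 *ᵥ traj q n F G x0 y s := fun s => by
    funext i
    change r (s + i) = T2 i ⬝ᵥ _
    rw [hr, dotProduct_traj_add q n F G x0 H y i fun j hj => hzero j (by omega)]
    rw [show T2 i = H ᵥ* F ^ (i : ℕ) from funext (hT2 i)]
  have hdecomp : ∀ s, traj q n F G x0 y s =
      V1 *ᵥ (T1 *ᵥ traj q n F G x0 y s) + V2 *ᵥ v s := fun s => by
    rw [hv, mulVec_mulVec, mulVec_mulVec, ← add_mulVec, hVT, one_mulVec]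
  have hz : ∀ s, T1 *ᵥ traj q n F G x0 y (s + 1) =
      F1 *ᵥ (T1 *ᵥ traj q n F G x0 y s) + F2 *ᵥ v s := fun s => by
    rw [traj, mulVec_add, mulVec_smul, hT1G, smul_zero, add_zero]
    conv_lhs => rw [hdecomp s]
    simp only [mulVec_add, mulVec_mulVec, F1, F2, Matrix.mul_assoc]
  have hsol := affine_recursion_solution F1 (fun s => T1 *ᵥ traj q n F G x0 y s)
    (fun s => F2 *ᵥ v s) hz t
  have hout : r (t + ν) = ψ ⬝ᵥ (T1 *ᵥ traj q n F G x0 y t) + φ ⬝ᵥ v t + y t * g := by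
    obtain ⟨k, rfl⟩ : ∃ k, ν = k + 1 := ⟨ν - 1, by omega⟩
    rw [hr, show t + (k + 1) = t + 1 + k by omega,
      dotProduct_traj_add q n F G x0 H y k fun j hj => hzero j (by omega),
      vecMul_pow_dotProduct_traj_succ]
    conv_lhs => rw [hdecomp t]
    rw [dotProduct_add, dotProduct_mulVec _ V1, dotProduct_mulVec _ V2]
    rfl
  have hg : g ≠ 0 := hlast
  simp only [traj] at hsol
  change y t + g⁻¹ * (ψ ⬝ᵥ ((F1 ^ t) *ᵥ (T1 *ᵥ x0))) = _
  rw [hout, hsol, dotProduct_add]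
  field_simp
  ring
end
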